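/- Self-subsumption is not symmetry-preserving: there exist CNF formulas F and F' such that F' is obtained from F by exhaustively applying self-subsuming resolution, Lit(F') = Lit(F), and there is a syntactic symmetry of F that is not a syntactic symmetry of F' (witnessed by F = (a₁∨b₁∨x̄₁∨ȳ₁)∧(a₁∨x₁)∧(b₁∨x̄₁∨y₁)∧(a₂∨b₂∨x̄₂∨ȳ₂)∧(a₂∨x₂)∧(b₂∨x̄₂∨y₂), in which a₁ and a₂ are interchangeable, and the exhaustive application yielding F' = (a₁∨b₁∨ȳ₁)∧(a₁∨x₁)∧(b₁∨x̄₁∨y₁)∧(a₂∨b₂∨x̄₂)∧(a₂∨x₂)∧(b₂∨x̄₂∨y₂), in which no syntactic symmetry interchanges a₁ and a₂). -/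

import Mathlib

/-- A literal over a variable type `V`: a variable or its negation. -/
inductive Lit (V : Type) where
  | pos : V → Lit V
  | neg : V → Lit V
deriving DecidableEq

variable {V : Type} [DecidableEq V]

/-- Negation of a literal (so that double negation is the identity). -/
def Lit.negate : Lit V → Lit V
  | .pos v => .neg v
  | .neg v => .pos v

/-- The underlying variable of a literal. -/
def Lit.var : Lit V → V
  | .pos v => v
  | .neg v => v

/-- A clause is a finite set of literals. -/
abbrev Clause (V : Type) := Finset (Lit V)

/-- A CNF formula is a finite set of clauses. -/
abbrev CNF (V : Type) := Finset (Clause V)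

/-- `Var(F)`: the variables occurring in a formula. -/
def CNF.vars (F : CNF V) : Finset V := Finset.sup F (fun C => Finset.image Lit.var C)

/-- `Lit(F) = Var(F) ∪ {v̄ : v ∈ Var(F)}`. -/
def CNF.lits (F : CNF V) : Finset (Lit V) :=
  Finset.image Lit.pos (CNF.vars F) ∪ Finset.image Lit.neg (CNF.vars F)

/-- The value of a literal under a complete assignment (given on the variables,
which determines a consistent complete assignment on all literals). -/
def Lit.val (σ : V → Bool) : Lit V → Bool
  | .pos v => σ v
  | .neg v => !(σ v)

/-- `C[σ]`: delete from `C` every literal mapped to `⊥` by `σ`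
(i.e. keep `l` with `¬l ∉ σ`). -/
def Clause.reduce (σ : V → Bool) (C : Clause V) : Clause V :=
  Finset.filter (fun l => Lit.val σ (Lit.negate l) = false) C

/-- `F[σ]`: delete every clause containing a literal mapped to `⊤` by `σ`
(for a complete assignment: every clause containing no false literal is kept)
and delete from each remaining clause every literal mapped to `⊥`. -/
def CNF.reduce (F : CNF V) (σ : V → Bool) : CNF V :=
  Finset.image (Clause.reduce σ) (Finset.filter (fun C => ∀ l ∈ C, Lit.val σ l = false) F)

/-- Apply a map on literals elementwise to clauses and formulas. -/
def CNF.map (φ : Lit V → Lit V) (F : CNF V) : CNF V :=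
  Finset.image (fun C => Finset.image φ C) F

/-- `φ` is a syntactic symmetry of `F`: a bijection of `Lit(F)` respecting
negation with `φ(F) = F`. -/
def IsSynSym (F : CNF V) (φ : Lit V → Lit V) : Prop :=
  Set.BijOn φ (CNF.lits F : Set (Lit V)) (CNF.lits F : Set (Lit V)) ∧
  (∀ l ∈ CNF.lits F, φ (Lit.negate l) = Lit.negate (φ l)) ∧
  CNF.map φ F = F

/-- `φ` is a semantic symmetry of `F`: a bijection of `Lit(F)` respecting
negation with `F[σ] = φ(F)[σ]` for every complete assignment `σ`. -/
def IsSemSym (F : CNF V) (φ : Lit V → Lit V) : Prop :=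
  Set.BijOn φ (CNF.lits F : Set (Lit V)) (CNF.lits F : Set (Lit V)) ∧
  (∀ l ∈ CNF.lits F, φ (Lit.negate l) = Lit.negate (φ l)) ∧
  ∀ σ : V → Bool, CNF.reduce F σ = CNF.reduce (CNF.map φ F) σ

/-- Extend a map defined on the literal set `S` by the identity outside `S`. -/
def extendId (S : Finset (Lit V)) (φ : Lit V → Lit V) : Lit V → Lit V :=
  fun l => if l ∈ S then φ l else l

/-- `F[l ↦ ⊤]`: delete every clause containing `l` and delete `l̄` from every
remaining clause. -/
def CNF.assignTrue (F : CNF V) (l : Lit V) : CNF V :=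
  Finset.image (fun C => Finset.erase C (Lit.negate l)) (Finset.filter (fun C => l ∉ C) F)

/-- One application of self-subsuming resolution: if `C₁ ∪ {x} ∈ F` and
`C₂ ∪ {x̄} ∈ F` with `C₁ ⊊ C₂`, remove the literal `x̄` from the clause
`C₂ ∪ {x̄}`. -/
def SSStep (F F' : CNF V) : Prop :=
  ∃ (D₁ D₂ : Clause V) (x : Lit V), D₁ ∈ F ∧ D₂ ∈ F ∧ x ∈ D₁ ∧ Lit.negate x ∈ D₂ ∧
    D₁.erase x ⊂ D₂.erase (Lit.negate x) ∧
    F' = insert (D₂.erase (Lit.negate x)) (F.erase D₂)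

def wF : CNF ℕ :=
  {{.pos 0, .pos 1, .neg 2, .neg 3}, {.pos 0, .pos 2}, {.pos 1, .neg 2, .pos 3},
   {.pos 4, .pos 5, .neg 6, .neg 7}, {.pos 4, .pos 6}, {.pos 5, .neg 6, .pos 7}}

def wF1 : CNF ℕ :=
  {{.pos 0, .pos 1, .neg 3}, {.pos 0, .pos 2}, {.pos 1, .neg 2, .pos 3},
   {.pos 4, .pos 5, .neg 6, .neg 7}, {.pos 4, .pos 6}, {.pos 5, .neg 6, .pos 7}}

def wF2 : CNF ℕ :=
  {{.pos 0, .pos 1, .neg 3}, {.pos 0, .pos 2}, {.pos 1, .neg 2, .pos 3},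
   {.pos 4, .pos 5, .neg 6}, {.pos 4, .pos 6}, {.pos 5, .neg 6, .pos 7}}

def wF3 : CNF ℕ :=
  {{.pos 0, .pos 1, .neg 3}, {.pos 0, .pos 2}, {.pos 1, .neg 2, .pos 3},
   {.pos 4, .pos 5}, {.pos 4, .pos 6}, {.pos 5, .neg 6, .pos 7}}

def wphi : Lit ℕ → Lit ℕ
  | .pos v => .pos ((v + 4) % 8)
  | .neg v => .neg ((v + 4) % 8)

theorem w_step1 : SSStep wF wF1 :=
  ⟨{.pos 0, .pos 2}, {.pos 0, .pos 1, .neg 2, .neg 3}, .pos 2, by decide +kernel⟩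

theorem w_step2 : SSStep wF1 wF2 :=
  ⟨{.pos 5, .neg 6, .pos 7}, {.pos 4, .pos 5, .neg 6, .neg 7}, .pos 7, by decide +kernel⟩

theorem w_step3 : SSStep wF2 wF3 :=
  ⟨{.pos 4, .pos 6}, {.pos 4, .pos 5, .neg 6}, .pos 6, by decide +kernel⟩

theorem w_final : ∀ D₁ ∈ wF3, ∀ D₂ ∈ wF3, ∀ x ∈ D₁, Lit.negate x ∈ D₂ →
    ¬ D₁.erase x ⊂ D₂.erase (Lit.negate x) := by decide +kernel

theorem w_maps : ∀ l ∈ CNF.lits wF, wphi l ∈ CNF.lits wF := by decide +kernel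

theorem w_invol : ∀ l ∈ CNF.lits wF, wphi (wphi l) = l := by decide +kernel

/-- Self-subsumption is not symmetry-preserving: there are CNF
formulas `F, F'` such that `F'` is obtained from `F` by exhaustively applying
self-subsuming resolution, `Lit(F') = Lit(F)`, and some syntactic symmetry of
`F` is not a syntactic symmetry of `F'`. -/
theorem self_subsumption_not_symmetry_preserving :
    ∃ F F' : CNF ℕ,
      Relation.ReflTransGen SSStep F F' ∧
      (∀ F'' : CNF ℕ, ¬ SSStep F' F'') ∧
      CNF.lits F' = CNF.lits F ∧
      ∃ φ : Lit ℕ → Lit ℕ, IsSynSym F φ ∧ ¬ IsSynSym F' φ := by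
  refine ⟨wF, wF3, ?_, ?_, by decide +kernel, wphi, ⟨⟨?_, ?_, ?_⟩, by decide +kernel,
    by decide +kernel⟩, ?_⟩
  · exact ((Relation.ReflTransGen.single w_step1).tail w_step2).tail w_step3
  · rintro F'' ⟨D₁, D₂, x, h1, h2, h3, h4, h5, -⟩
    exact w_final D₁ h1 D₂ h2 x h3 h4 h5
  · intro l hl
    exact w_maps l hl
  · intro l hl m hm h
    rw [← w_invol l hl, ← w_invol m hm, h]
  · intro l hl
    exact ⟨wphi l, w_maps l hl, w_invol l hl⟩
  · rintro ⟨-, -, h⟩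
    revert h
    decide +kernel
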